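/- arXiv:1407.5958 — 4 statements merged into one kernel-verified Lean document; each statement's English description precedes it below -/
import Mathlib

section
/- Let d ≥ 2. A d² × d² complex matrix A satisfies (U ⊗ U) A (U† ⊗ U†) = A for every unitary d × d matrix U if and only if there exist scalars α, β ∈ ℂ such that A = α·I + β·V, where I is the d² × d² identity and V is the flip operator. -/
open Matrix Kronecker

/-- The flip operator on `ℂ^d ⊗ ℂ^d`, identified with `ℂ^(d²)` via the Kronecker
product: `V[(i,j),(k,l)] = 1` if `i = l` and `j = k`, and `0` otherwise. -/
noncomputable def flipOp (d : ℕ) : Matrix (Fin d × Fin d) (Fin d × Fin d) ℂ :=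
  Matrix.of fun p q => if p.1 = q.2 ∧ p.2 = q.1 then 1 else 0

theorem flipOp_apply (d : ℕ) (p q : Fin d × Fin d) :
    flipOp d p q = if p = q.swap then 1 else 0 := by
  simp [flipOp, Prod.ext_iff]

theorem mul_flipOp_apply {d : ℕ} (M : Matrix (Fin d × Fin d) (Fin d × Fin d) ℂ)
    (p q : Fin d × Fin d) : (M * flipOp d) p q = M p q.swap := by
  simp [Matrix.mul_apply, flipOp_apply]

theorem flipOp_mul_apply {d : ℕ} (M : Matrix (Fin d × Fin d) (Fin d × Fin d) ℂ)
    (p q : Fin d × Fin d) : (flipOp d * M) p q = M p.swap q := by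
  have h (x : Fin d × Fin d) : p = x.swap ↔ x = p.swap := by
    constructor <;> rintro rfl <;> simp
  simp [Matrix.mul_apply, flipOp_apply, h]

theorem kronecker_self_mul_flipOp {d : ℕ} (U : Matrix (Fin d) (Fin d) ℂ) :
    (U ⊗ₖ U) * flipOp d = flipOp d * (U ⊗ₖ U) := by
  ext p q
  simp [mul_flipOp_apply, flipOp_mul_apply, mul_comm]

theorem kronecker_self_mul_conjTranspose {d : ℕ} {U : Matrix (Fin d) (Fin d) ℂ}
    (hU : U ∈ Matrix.unitaryGroup (Fin d) ℂ) : (U ⊗ₖ U) * (Uᴴ ⊗ₖ Uᴴ) = 1 := by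
  have h : U * Uᴴ = 1 := Matrix.mem_unitaryGroup_iff.mp hU
  rw [← Matrix.mul_kronecker_mul, h, Matrix.one_kronecker_one]

theorem conj_kronecker_self_eq_iff {d : ℕ} {U : Matrix (Fin d) (Fin d) ℂ}
    (hU : U ∈ Matrix.unitaryGroup (Fin d) ℂ) (A : Matrix (Fin d × Fin d) (Fin d × Fin d) ℂ) :
    (U ⊗ₖ U) * A * (Uᴴ ⊗ₖ Uᴴ) = A ↔ (U ⊗ₖ U) * A = A * (U ⊗ₖ U) := by
  have h := kronecker_self_mul_conjTranspose hU
  have h' := mul_eq_one_comm.mp h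
  constructor <;> intro e
  · conv_rhs => rw [← e]
    rw [Matrix.mul_assoc, h', Matrix.mul_one]
  · rw [e, Matrix.mul_assoc, h, Matrix.mul_one]

/-- The diagonal unitary with entry `i` (the imaginary unit) at `m` and `1` elsewhere. -/
noncomputable def phaseAt {d : ℕ} (m : Fin d) : Matrix (Fin d) (Fin d) ℂ :=
  diagonal fun k => if k = m then Complex.I else 1

theorem phaseAt_mem_unitaryGroup {d : ℕ} (m : Fin d) :
    phaseAt m ∈ Matrix.unitaryGroup (Fin d) ℂ := by
  rw [Matrix.mem_unitaryGroup_iff, phaseAt, star_eq_conjTranspose, diagonal_conjTranspose,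
    diagonal_mul_diagonal, ← diagonal_one]
  congr 1
  ext k
  by_cases h : k = m <;> simp [h]

/-- The reflection in the hyperplane orthogonal to `e i + 2 • e j`. -/
noncomputable def pairReflection {d : ℕ} (i j : Fin d) : Matrix (Fin d) (Fin d) ℂ :=
  1 - (2 / 5 : ℂ) • vecMulVec (Pi.single i 1 + Pi.single j 2) (Pi.single i 1 + Pi.single j 2)

theorem pairReflection_mem_unitaryGroup {d : ℕ} {i j : Fin d} (hij : i ≠ j) :
    pairReflection i j ∈ Matrix.unitaryGroup (Fin d) ℂ := by
  set w : Fin d → ℂ := Pi.single i 1 + Pi.single j 2 with hw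
  have hstar : star w = w := by
    ext k
    simp [hw, Pi.single_apply, apply_ite (starRingEnd ℂ), map_ofNat]
  have hdot : w ⬝ᵥ w = 5 := by
    simp [hw, hij, hij.symm]
    norm_num
  have hsq : vecMulVec w w * vecMulVec w w = (5 : ℂ) • vecMulVec w w := by
    rw [vecMulVec_mul_vecMulVec, hdot, vecMulVec_smul]
  have hsa : star (pairReflection i j) = pairReflection i j := by
    rw [pairReflection, ← hw, star_eq_conjTranspose, conjTranspose_sub, conjTranspose_smul,
      conjTranspose_vecMulVec, hstar]
    simp
  rw [Matrix.mem_unitaryGroup_iff, hsa, pairReflection, ← hw]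
  simp only [sub_mul, mul_sub, one_mul, mul_one, smul_mul_smul_comm, hsq]
  module

/-- A matrix commuting with all `phaseAt m ⊗ phaseAt m` is supported on the entries
where the row and column indices agree up to a flip. -/
theorem apply_eq_zero_of_commute_phaseAt {d : ℕ} {A : Matrix (Fin d × Fin d) (Fin d × Fin d) ℂ}
    (hA : ∀ m : Fin d, (phaseAt m ⊗ₖ phaseAt m) * A = A * (phaseAt m ⊗ₖ phaseAt m))
    {p q : Fin d × Fin d} (h₁ : p ≠ q) (h₂ : p ≠ q.swap) : A p q = 0 := by
  obtain ⟨i, j⟩ := p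
  obtain ⟨k, l⟩ := q
  have key (m : Fin d) : (if i = m then Complex.I else 1) * (if j = m then Complex.I else 1) *
      A (i, j) (k, l) = A (i, j) (k, l) *
        ((if k = m then Complex.I else 1) * (if l = m then Complex.I else 1)) := by
    have := congrFun₂ (hA m) (i, j) (k, l)
    simpa only [phaseAt, diagonal_kronecker_diagonal, diagonal_mul, mul_diagonal] using this
  have hI : Complex.I * Complex.I = -1 := Complex.I_mul_I
  by_contra hne
  have cancel (m : Fin d) := mul_right_cancel₀ hne ((key m).trans (mul_comm _ _))
  have hI1 : Complex.I ≠ 1 := fun h => by simpa using congrArg Complex.re h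
  have hI2 : Complex.I ≠ -1 := fun h => by simpa using congrArg Complex.re h
  have hci := cancel i
  have hcj := cancel j
  have hone : (-1 : ℂ) ≠ 1 := by norm_num
  simp only [ne_eq, Prod.mk.injEq, Prod.swap_prod_mk] at h₁ h₂
  grind

/-- Entrywise form of commutation with `U ⊗ U` for a matrix supported on the identity
and flip positions. -/
theorem commute_kronecker_self_entry {d : ℕ} {b c : Fin d × Fin d → ℂ}
    {U : Matrix (Fin d) (Fin d) ℂ}
    (h : (U ⊗ₖ U) * (diagonal b + diagonal c * flipOp d) =
      (diagonal b + diagonal c * flipOp d) * (U ⊗ₖ U)) (i j k l : Fin d) :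
    U i k * U j l * b (k, l) + U i l * U j k * c (l, k) =
      b (i, j) * (U i k * U j l) + c (i, j) * (U j k * U i l) := by
  have := congrFun₂ h (i, j) (k, l)
  rw [mul_add, add_mul, ← Matrix.mul_assoc, Matrix.mul_assoc (diagonal c)] at this
  simpa [mul_flipOp_apply, flipOp_mul_apply, mul_diagonal, diagonal_mul] using this

theorem exists_combination_of_commute {d : ℕ} (hd : 2 ≤ d)
    {A : Matrix (Fin d × Fin d) (Fin d × Fin d) ℂ}
    (hA : ∀ U ∈ Matrix.unitaryGroup (Fin d) ℂ, (U ⊗ₖ U) * A = A * (U ⊗ₖ U)) :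
    ∃ α β : ℂ, A = α • (1 : Matrix (Fin d × Fin d) (Fin d × Fin d) ℂ) + β • flipOp d := by
  have hsupp {p q : Fin d × Fin d} : p ≠ q → p ≠ q.swap → A p q = 0 :=
    apply_eq_zero_of_commute_phaseAt fun m => hA _ (phaseAt_mem_unitaryGroup m)
  obtain ⟨b, hb⟩ : ∃ b : Fin d × Fin d → ℂ, ∀ p, b p = A p p := ⟨_, fun _ => rfl⟩
  obtain ⟨c, hc⟩ : ∃ c : Fin d × Fin d → ℂ,
      ∀ p, c p = if p.1 = p.2 then 0 else A p p.swap := ⟨_, fun _ => rfl⟩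
  have hdecomp : A = diagonal b + diagonal c * flipOp d := by
    ext ⟨i, j⟩ ⟨k, l⟩
    have := @hsupp (i, j) (k, l)
    simp only [Matrix.add_apply, mul_flipOp_apply, diagonal_apply, hb, hc, Prod.swap_prod_mk,
      Prod.mk.injEq, ne_eq] at this ⊢
    grind
  have hcd (i : Fin d) : c (i, i) = 0 := by simp [hc]
  have entry {i j : Fin d} (hij : i ≠ j) := commute_kronecker_self_entry
    (hdecomp ▸ hA _ (pairReflection_mem_unitaryGroup hij))
  have hii {i j : Fin d} (hij : i ≠ j) : pairReflection i j i i = 3 / 5 := by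
    simp [pairReflection, vecMulVec_apply, hij]; norm_num
  have hoff {i j : Fin d} (hij : i ≠ j) : pairReflection i j i j = -4 / 5 := by
    simp [pairReflection, vecMulVec_apply, hij, hij.symm]; norm_num
  have hoff' {i j : Fin d} (hij : i ≠ j) : pairReflection i j j i = -4 / 5 := by
    simp [pairReflection, vecMulVec_apply, hij, hij.symm]; norm_num
  have hbd {i j : Fin d} (hij : i ≠ j) : b (i, i) = b (j, j) := by
    have := entry hij i i j j
    simp only [hoff hij, hcd] at this
    linear_combination (-25 / 16) * this
  have hbc {i j : Fin d} (hij : i ≠ j) : b (i, i) = b (i, j) + c (i, j) := by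
    have := entry hij i j i i
    simp only [hii hij, hoff' hij, hcd] at this
    linear_combination (-25 / 12) * this
  have hbc' {i j : Fin d} (hij : i ≠ j) : b (i, i) = b (i, j) + c (j, i) := by
    have := entry hij i i i j
    simp only [hii hij, hoff hij, hcd] at this
    linear_combination (25 / 12) * this
  have hbs {i j : Fin d} (hij : i ≠ j) : b (i, j) = b (j, i) := by
    linear_combination hbc' hij.symm - hbc hij + hbd hij
  have hbr {i j k : Fin d} (hij : i ≠ j) (hik : i ≠ k) : b (i, j) = b (i, k) := by
    rcases eq_or_ne j k with rfl | hjk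
    · rfl
    have := entry hjk i j i k
    have h₁ : pairReflection j k i i = 1 := by
      simp [pairReflection, vecMulVec_apply, hij, hik]
    have h₂ : pairReflection j k i k = 0 := by
      simp [pairReflection, vecMulVec_apply, hij, hik]
    simp only [h₁, h₂, hoff hjk] at this
    linear_combination (5 / 4) * this
  have hbconst {i j k l : Fin d} (hij : i ≠ j) (hkl : k ≠ l) : b (i, j) = b (k, l) := by
    rcases eq_or_ne i l with rfl | hil
    · rw [hbs hkl, hbr hij hkl.symm]
    · rw [hbr hij hil, hbs hil, hbr hil.symm hkl.symm, hbs hkl]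
  let x : Fin d := ⟨0, by lia⟩
  let y : Fin d := ⟨1, by lia⟩
  have hxy : x ≠ y := by simp [x, y]
  have hbx (i : Fin d) : b (i, i) = b (x, x) := by
    rcases eq_or_ne i x with rfl | h
    · rfl
    · exact hbd h
  refine ⟨b (x, y), c (x, y), ?_⟩
  rw [hdecomp]
  ext ⟨i, j⟩ ⟨k, l⟩
  have e₁ := hbc hxy
  have e₂ := hbx i
  have e₃ := hcd i
  rcases eq_or_ne i j with rfl | hij
  · simp only [Matrix.add_apply, Matrix.smul_apply, smul_eq_mul, mul_flipOp_apply, diagonal_apply,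
      Matrix.one_apply, flipOp_apply, Prod.swap_prod_mk, Prod.mk.injEq]
    grind
  · have e₄ := hbc hij
    have e₅ := hbconst hij hxy
    simp only [Matrix.add_apply, Matrix.smul_apply, smul_eq_mul, mul_flipOp_apply, diagonal_apply,
      Matrix.one_apply, flipOp_apply, Prod.swap_prod_mk, Prod.mk.injEq]
    grind

/-- A `d² × d²` complex matrix `A` is invariant under conjugation by `U ⊗ U` for
every unitary `U` if and only if `A` is a linear combination of the identity and
the flip operator. -/
theorem uu_invariant_iff_combination_id_flip (d : ℕ) (hd : 2 ≤ d)
    (A : Matrix (Fin d × Fin d) (Fin d × Fin d) ℂ) :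
    (∀ U : Matrix (Fin d) (Fin d) ℂ, U ∈ Matrix.unitaryGroup (Fin d) ℂ →
        (U ⊗ₖ U) * A * (Uᴴ ⊗ₖ Uᴴ) = A) ↔
      ∃ α β : ℂ, A = α • (1 : Matrix (Fin d × Fin d) (Fin d × Fin d) ℂ) + β • flipOp d := by
  constructor
  · intro h
    exact exists_combination_of_commute hd fun U hU =>
      (conj_kronecker_self_eq_iff hU A).mp (h U hU)
  · rintro ⟨α, β, rfl⟩ U hU
    rw [conj_kronecker_self_eq_iff hU]
    simp [mul_add, add_mul, kronecker_self_mul_flipOp]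
end

section
/- Let d ≥ 2 and let W be a density matrix on ℂ^d ⊗ ℂ^d satisfying (U ⊗ U) W (U† ⊗ U†) = W for every unitary d × d matrix U (a Werner state). Setting φ = tr(W·V), one has W = ((d − φ)·I + (d·φ − 1)·V) / (d³ − d), where I is the d² × d² identity and V is the flip operator. -/
open Matrix Kronecker
open scoped ComplexOrder

namespace Werner

variable {ι : Type*} [Fintype ι] [DecidableEq ι]

/-- `W` is fixed by conjugation with `U ⊗ U` for every unitary `U`. -/
def IsInvariant (W : Matrix (ι × ι) (ι × ι) ℂ) : Prop :=
  ∀ U : Matrix ι ι ℂ, U ∈ Matrix.unitaryGroup ι ℂ → (U ⊗ₖ U) * W * (Uᴴ ⊗ₖ Uᴴ) = W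

variable {W : Matrix (ι × ι) (ι × ι) ℂ}

theorem IsInvariant.commute (hW : IsInvariant W) {U : Matrix ι ι ℂ}
    (hU : U ∈ Matrix.unitaryGroup ι ℂ) : (U ⊗ₖ U) * W = W * (U ⊗ₖ U) := by
  have h : Uᴴ * U = 1 := Matrix.mem_unitaryGroup_iff'.1 hU
  calc (U ⊗ₖ U) * W = (U ⊗ₖ U) * W * (Uᴴ ⊗ₖ Uᴴ) * (U ⊗ₖ U) := by
        rw [Matrix.mul_assoc _ (Uᴴ ⊗ₖ Uᴴ), ← Matrix.mul_kronecker_mul, h,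
          Matrix.one_kronecker_one, Matrix.mul_one]
    _ = W * (U ⊗ₖ U) := by rw [hW U hU]

/-- Invariance under diagonal unitaries kills all entries of nonzero weight. -/
theorem IsInvariant.eq_or_eq_swap (hW : IsInvariant W) {p q : ι × ι} (h : W p q ≠ 0) :
    p = q ∨ p = q.swap := by
  have key (a : ι) : (if p.1 = a then Complex.I else 1) * (if p.2 = a then Complex.I else 1) =
      (if q.1 = a then Complex.I else 1) * (if q.2 = a then Complex.I else 1) := by
    have hU : Matrix.diagonal (fun i => if i = a then Complex.I else 1) ∈
        Matrix.unitaryGroup ι ℂ := by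
      rw [Matrix.mem_unitaryGroup_iff, Matrix.star_eq_conjTranspose,
        Matrix.diagonal_conjTranspose, Matrix.diagonal_mul_diagonal, ← Matrix.diagonal_one]
      congr 1
      ext i
      by_cases hi : i = a <;> simp [hi]
    have := congrFun₂ (hW.commute hU) p q
    rw [Matrix.diagonal_kronecker_diagonal, Matrix.diagonal_mul, Matrix.mul_diagonal,
      mul_comm] at this
    exact mul_left_cancel₀ h this
  obtain ⟨i, j⟩ := p
  obtain ⟨k, l⟩ := q
  have h1 := key i
  have h2 := key j
  have hI : Complex.I ≠ 1 := fun h => by simpa using congrArg Complex.im h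
  have hI' : (-1 : ℂ) ≠ Complex.I := fun h => by simpa using congrArg Complex.im h
  have hI'' : (-1 : ℂ) ≠ 1 := by norm_num
  have hII := Complex.I_mul_I
  by_cases hij : i = j <;> by_cases hik : i = k <;> by_cases hil : i = l <;>
    by_cases hjk : j = k <;> by_cases hjl : j = l <;> grind

theorem IsInvariant.apply_perm (hW : IsInvariant W) (σ : Equiv.Perm ι) (i j k l : ι) :
    W (σ i, σ j) (σ k, σ l) = W (i, j) (k, l) := by
  have hU : σ.permMatrix ℂ ∈ Matrix.unitaryGroup ι ℂ := by
    rw [Matrix.mem_unitaryGroup_iff, Matrix.star_eq_conjTranspose,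
      Matrix.conjTranspose_permMatrix, ← Matrix.permMatrix_mul]
    simp
  have := congrFun₂ (hW.commute hU) (i, j) (σ k, σ l)
  simpa [Matrix.mul_apply, Fintype.sum_prod_type, Equiv.Perm.permMatrix,
    PEquiv.toMatrix_apply, Equiv.toPEquiv_apply, ite_and, mul_ite] using this

/-- The rational reflection in the plane of `e_i, e_j` along `e_i + 2 e_j`. -/
theorem exists_mem_unitaryGroup {i j : ι} (hij : i ≠ j) :
    ∃ U ∈ Matrix.unitaryGroup ι ℂ, U i i * U j i ≠ 0 := by
  set w : ι → ℂ := Pi.single i 1 + Pi.single j 2 with hw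
  have hww : w ⬝ᵥ w = 5 := by
    simp [hw, hij, hij.symm]; norm_num
  have hstar : star w = w := by
    ext k; by_cases h1 : k = i <;> by_cases h2 : k = j <;> simp_all
  refine ⟨1 - (2 / 5 : ℂ) • Matrix.vecMulVec w w, ?_, ?_⟩
  · rw [Matrix.mem_unitaryGroup_iff, Matrix.star_eq_conjTranspose]
    have : (1 - (2 / 5 : ℂ) • Matrix.vecMulVec w w)ᴴ = 1 - (2 / 5 : ℂ) • Matrix.vecMulVec w w := by
      simp [Matrix.conjTranspose_vecMulVec, hstar]
    rw [this]
    simp only [sub_mul, mul_sub, smul_mul_smul_comm, Matrix.vecMulVec_mul_vecMulVec, hww,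
      one_mul, mul_one]
    ext a b
    simp [Matrix.vecMulVec_apply]
    ring
  · simp [Matrix.vecMulVec_apply, hw, hij, hij.symm]
    norm_num

theorem IsInvariant.apply_diag (hW : IsInvariant W) {i j : ι} (hij : i ≠ j) :
    W (i, i) (i, i) = W (i, j) (i, j) + W (i, j) (j, i) := by
  obtain ⟨U, hU, h0⟩ := exists_mem_unitaryGroup hij
  have h := congrFun₂ (hW.commute hU) (i, j) (i, i)
  rw [Matrix.mul_apply, Matrix.mul_apply, Fintype.sum_eq_single (i, i),
    Fintype.sum_eq_add (i, j) (j, i)] at h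
  · simp only [Matrix.kronecker_apply] at h
    apply mul_left_cancel₀ h0
    linear_combination h
  · simp [hij]
  · rintro p ⟨h1, h2⟩
    rw [mul_eq_zero]
    left
    by_contra hne
    rcases hW.eq_or_eq_swap hne with h | h
    · exact h1 h.symm
    · exact h2 (Prod.swap_injective h.symm)
  · intro p hp
    rw [mul_eq_zero]
    right
    by_contra hne
    rcases hW.eq_or_eq_swap hne with h | h <;> exact hp h

/-- An invariant matrix is a linear combination of the identity and the flip. -/
theorem IsInvariant.exists_eq [Nontrivial ι] (hW : IsInvariant W) :
    ∃ b c : ℂ, ∀ p q, W p q = b * (if p = q then 1 else 0) + c * (if p = q.swap then 1 else 0) := by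
  obtain ⟨i₀, j₀, h₀⟩ := exists_pair_ne ι
  have hoff {i j : ι} (hij : i ≠ j) : W (i, j) (i, j) = W (i₀, j₀) (i₀, j₀) ∧
      W (i, j) (j, i) = W (i₀, j₀) (j₀, i₀) := by
    obtain ⟨σ, rfl, rfl⟩ :=
      MulAction.is_two_pretransitive_iff.1 (Equiv.Perm.isMultiplyPretransitive ι 2) h₀ hij
    exact ⟨hW.apply_perm .., hW.apply_perm ..⟩
  refine ⟨W (i₀, j₀) (i₀, j₀), W (i₀, j₀) (j₀, i₀), fun p q => ?_⟩
  by_cases h : W p q = 0 ∧ p ≠ q ∧ p ≠ q.swap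
  · simp [h]
  have h' : p = q ∨ p = q.swap := by
    by_contra! hne
    exact h ⟨by_contra fun h0 => (hW.eq_or_eq_swap h0).elim hne.1 hne.2, hne⟩
  obtain ⟨k, l⟩ := q
  by_cases hkl : k = l
  · subst hkl
    obtain ⟨j, hj⟩ := exists_ne k
    obtain rfl : p = (k, k) := by simpa using h'
    simp [hW.apply_diag hj.symm, hoff hj.symm]
  · rcases h' with rfl | rfl
    · simp [hoff hkl, hkl]
    · simp [hoff (Ne.symm hkl), hkl, Ne.symm hkl]

end Werner

/-- A Werner state `W` (a density matrix invariant under conjugation by `U ⊗ U`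
for all unitaries `U`) satisfies `W = ((d − φ)·I + (d·φ − 1)·V) / (d³ − d)` where
`φ = tr(W·V)`. -/
theorem werner_state_form (d : ℕ) (hd : 2 ≤ d)
    (W : Matrix (Fin d × Fin d) (Fin d × Fin d) ℂ)
    (hpsd : W.PosSemidef) (htr : W.trace = 1)
    (hinv : ∀ U : Matrix (Fin d) (Fin d) ℂ, U ∈ Matrix.unitaryGroup (Fin d) ℂ →
        (U ⊗ₖ U) * W * (Uᴴ ⊗ₖ Uᴴ) = W) :
    W = ((d : ℂ) ^ 3 - (d : ℂ))⁻¹ •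
        (((d : ℂ) - Matrix.trace (W * flipOp d)) •
            (1 : Matrix (Fin d × Fin d) (Fin d × Fin d) ℂ) +
          ((d : ℂ) * Matrix.trace (W * flipOp d) - 1) • flipOp d) := by
  have : Nontrivial (Fin d) := Fin.nontrivial_iff_two_le.2 hd
  obtain ⟨b, c, hbc⟩ := Werner.IsInvariant.exists_eq (W := W) hinv
  have hW : W = b • 1 + c • flipOp d := by
    ext ⟨i, j⟩ ⟨k, l⟩
    simp [hbc, flipOp, Matrix.one_apply]
  have hflip : (flipOp d).trace = d := by
    simp [Matrix.trace, flipOp, Fintype.sum_prod_type, ite_and, eq_comm]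
  have hsq : flipOp d * flipOp d = 1 := by
    ext ⟨i, j⟩ ⟨k, l⟩
    simp [Matrix.mul_apply, flipOp, Fintype.sum_prod_type, ite_and, Matrix.one_apply]
  have h1 : b * d ^ 2 + c * d = 1 := by
    rw [← htr, hW]
    simp [hflip, sq]
  have h2 : (W * flipOp d).trace = b * d + c * d ^ 2 := by
    rw [hW]
    simp [add_mul, hsq, hflip, sq]
  have hne : (d : ℂ) ^ 3 - d ≠ 0 := by
    have hd' : d ^ 3 ≠ d := by
      have : d * 1 < d * d ^ 2 := by gcongr; nlinarith
      exact (by linarith [pow_succ' d 2] : d < d ^ 3).ne'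
    exact sub_ne_zero.2 (by exact_mod_cast hd')
  rw [h2, eq_inv_smul_iff₀ hne, hW, smul_add, smul_smul, smul_smul]
  congr 2
  · linear_combination (d : ℂ) * h1
  · linear_combination (-1 : ℂ) * h1
end

section
/- Let d ≥ 2 and φ ∈ [−1, 1], and let W_φ = ((d − φ)·I + (d·φ − 1)·V) / (d³ − d) be the Werner state on ℂ^d ⊗ ℂ^d with parameter φ. Then W_φ is separable if and only if φ ≥ 0. -/
open Matrix Kronecker
open scoped ComplexOrder

/-- A density matrix `ρ` on `ℂ^d ⊗ ℂ^d` is separable if it is a finite convex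
combination `Σᵢ pᵢ Aᵢ ⊗ Bᵢ` of Kronecker products of density matrices on `ℂ^d`. -/
def SeparableState (d : ℕ) (ρ : Matrix (Fin d × Fin d) (Fin d × Fin d) ℂ) : Prop :=
  ∃ (n : ℕ) (p : Fin n → ℝ) (A B : Fin n → Matrix (Fin d) (Fin d) ℂ),
    (∀ i, 0 ≤ p i) ∧ (∑ i, p i = 1) ∧
    (∀ i, (A i).PosSemidef ∧ (A i).trace = 1) ∧
    (∀ i, (B i).PosSemidef ∧ (B i).trace = 1) ∧
    ρ = ∑ i, (p i : ℂ) • (A i ⊗ₖ B i)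

/-- The convex cone generated by the Kronecker products of density matrices. -/
noncomputable def separableCone (d : ℕ) :
    Submodule NNReal (Matrix (Fin d × Fin d) (Fin d × Fin d) ℂ) :=
  Submodule.span NNReal {M | ∃ A B : Matrix (Fin d) (Fin d) ℂ,
    (A.PosSemidef ∧ A.trace = 1) ∧ (B.PosSemidef ∧ B.trace = 1) ∧ M = A ⊗ₖ B}

lemma separableState_of_mem_separableCone {d : ℕ}
    {ρ : Matrix (Fin d × Fin d) (Fin d × Fin d) ℂ}
    (hρ : ρ ∈ separableCone d) (htr : ρ.trace = 1) : SeparableState d ρ := by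
  obtain ⟨n, p, g, hg⟩ := Submodule.mem_span_set'.mp hρ
  choose A B hA hB hAB using fun i => (g i).2
  have hsum : ρ = ∑ i, (((p i : NNReal) : ℝ) : ℂ) • (A i ⊗ₖ B i) := by
    rw [← hg]
    refine Finset.sum_congr rfl fun i _ => ?_
    rw [hAB]
    rfl
  refine ⟨n, fun i => p i, A, B, fun i => (p i).2, ?_, hA, hB, hsum⟩
  rw [hsum] at htr
  simp only [trace_sum, trace_smul, trace_kronecker, (hA _).2, (hB _).2, mul_one,
    smul_eq_mul] at htr
  beta_reduce
  exact_mod_cast htr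

lemma smul_mem_separableCone {d : ℕ} {c : ℂ} (hc : 0 ≤ c)
    {M : Matrix (Fin d × Fin d) (Fin d × Fin d) ℂ} (hM : M ∈ separableCone d) :
    c • M ∈ separableCone d := by
  obtain ⟨r, hr, rfl⟩ := RCLike.nonneg_iff_exists_ofReal.mp hc
  exact (separableCone d).smul_mem (⟨r, hr⟩ : NNReal) hM

lemma kronecker_mem_separableCone {d : ℕ} {A B : Matrix (Fin d) (Fin d) ℂ}
    (hA : A.PosSemidef) (hB : B.PosSemidef) : A ⊗ₖ B ∈ separableCone d := by
  by_cases hA0 : A.trace = 0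
  · simp [hA.trace_eq_zero_iff.mp hA0]
  by_cases hB0 : B.trace = 0
  · simp [hB.trace_eq_zero_iff.mp hB0]
  have hAn := hA.trace_nonneg
  have hBn := hB.trace_nonneg
  have hgen : (A.trace⁻¹ • A) ⊗ₖ (B.trace⁻¹ • B) ∈ separableCone d :=
    Submodule.subset_span ⟨_, _,
      ⟨hA.smul (inv_nonneg.mpr hAn), by simp [trace_smul, hA0]⟩,
      ⟨hB.smul (inv_nonneg.mpr hBn), by simp [trace_smul, hB0]⟩, rfl⟩
  have h := smul_mem_separableCone (mul_nonneg hAn hBn) hgen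
  rwa [smul_kronecker, kronecker_smul, smul_smul, smul_smul,
    show A.trace * B.trace * A.trace⁻¹ * B.trace⁻¹ = 1 by field_simp, one_smul] at h

lemma diagonal_mem_separableCone {d : ℕ} {f : Fin d × Fin d → ℂ} (hf : ∀ p, 0 ≤ f p) :
    diagonal f ∈ separableCone d := by
  have h : diagonal f = ∑ p : Fin d × Fin d, f p •
      (diagonal (Pi.single p.1 (1 : ℂ)) ⊗ₖ diagonal (Pi.single p.2 (1 : ℂ))) := by
    ext a b
    simp only [Matrix.sum_apply, Matrix.smul_apply, diagonal_kronecker_diagonal, diagonal_apply]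
    split_ifs with hab
    · rw [Finset.sum_eq_single a]
      · simp
      · rintro ⟨p, q⟩ - hne
        by_cases h1 : a.1 = p
        · have h2 : a.2 ≠ q := fun h2 => hne (Prod.ext h1.symm h2.symm)
          simp [h2]
        · simp [h1]
      · simp
    · simp
  have hpos (i : Fin d) : (diagonal (Pi.single i (1 : ℂ))).PosSemidef :=
    PosSemidef.diagonal (Pi.single_nonneg.mpr zero_le_one)
  rw [h]
  exact Submodule.sum_mem _ fun p _ =>
    smul_mem_separableCone (hf p) (kronecker_mem_separableCone (hpos _) (hpos _))

/-- Fourth moments of independent uniformly random fourth roots of unity. -/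
lemma sum_phases_eq {ι : Type*} [Fintype ι] [DecidableEq ι]
    [Fintype (rootsOfUnity 4 ℂ)] (a b c e : ι) :
    ∑ z : ι → rootsOfUnity 4 ℂ,
        (((z a * (z b)⁻¹ * (z c * (z e)⁻¹) : rootsOfUnity 4 ℂ) : ℂˣ) : ℂ) =
      if (a = b ∧ c = e) ∨ (a = e ∧ c = b) then
        (Fintype.card (ι → rootsOfUnity 4 ℂ) : ℂ) else 0 := by
  let ev (i : ι) : (ι → rootsOfUnity 4 ℂ) →* rootsOfUnity 4 ℂ := Pi.evalMonoidHom _ i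
  let χ : (ι → rootsOfUnity 4 ℂ) →* ℂ := (Units.coeHom ℂ).comp
    ((rootsOfUnity 4 ℂ).subtype.comp (ev a * (ev b)⁻¹ * (ev c * (ev e)⁻¹)))
  split_ifs with h
  · rw [Finset.sum_congr rfl (g := fun _ => (1 : ℂ))]
    · simp
    · rintro z -
      rcases h with ⟨rfl, rfl⟩ | ⟨rfl, rfl⟩ <;> simp
  · refine sum_hom_units_eq_zero χ fun hχ => h ?_
    have hI : (Units.mk0 Complex.I Complex.I_ne_zero) ∈ rootsOfUnity 4 ℂ := by
      rw [mem_rootsOfUnity]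
      ext
      simp
    let ω : rootsOfUnity 4 ℂ := ⟨_, hI⟩
    have key (m : ι) : (if a = m then Complex.I else 1) * (if b = m then Complex.I else 1)⁻¹ *
        ((if c = m then Complex.I else 1) * (if e = m then Complex.I else 1)⁻¹) = 1 := by
      have := DFunLike.congr_fun hχ (Pi.mulSingle m ω)
      have hval (i : ι) : (((Pi.mulSingle m ω : ι → rootsOfUnity 4 ℂ) i : ℂˣ) : ℂ) =
          if i = m then Complex.I else 1 := by
        rw [Pi.mulSingle_apply]
        split_ifs <;> rfl
      simpa [χ, ev, hval] using this
    have hI1 : Complex.I ≠ 1 := fun h => by simpa using congrArg Complex.re h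
    have hne (m : ι) : (if m = c then Complex.I else 1) ≠ 0 := by
      split_ifs <;> simp
    by_cases hab : a = b
    · subst hab
      have hc := key c
      rw [mul_inv_cancel₀ (hne a)] at hc
      by_cases hce : e = c
      · exact .inl ⟨rfl, hce.symm⟩
      · simp [hce, hI1] at hc
    by_cases hae : a = e
    · subst hae
      have hc := key c
      rw [mul_mul_mul_comm, mul_comm _⁻¹, mul_comm, mul_assoc] at hc
      by_cases hcb : b = c
      · exact .inr ⟨rfl, hcb.symm⟩
      · by_cases hac : a = c <;> simp [hcb, hac, hI1] at hc
    have ha := key a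
    have hII : (-1 : ℂ) ≠ 1 := by norm_num
    by_cases hca : c = a <;> simp [Ne.symm hab, Ne.symm hae, hca, hI1, hII] at ha

/-- Averaging `D J Dᴴ ⊗ D G Dᴴ` over diagonal matrices `D` of random phases, with `J` the
all-ones matrix, keeps exactly the entries invariant under all the phases. -/
lemma phaseAverage_mem_separableCone {d : ℕ} {G : Matrix (Fin d) (Fin d) ℂ}
    (hG : G.PosSemidef) :
    (Matrix.of fun p q : Fin d × Fin d =>
      if (p.1 = q.1 ∧ p.2 = q.2) ∨ (p.1 = q.2 ∧ p.2 = q.1) then G p.2 q.2 else 0)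
      ∈ separableCone d := by
  have := Fintype.ofFinite (rootsOfUnity 4 ℂ)
  let D (z : Fin d → rootsOfUnity 4 ℂ) : Matrix (Fin d) (Fin d) ℂ :=
    diagonal fun i => ((z i : ℂˣ) : ℂ)
  let N : ℂ := Fintype.card (Fin d → rootsOfUnity 4 ℂ)
  have hN : N ≠ 0 := Nat.cast_ne_zero.mpr Fintype.card_ne_zero
  have hstar (w : rootsOfUnity 4 ℂ) : star ((w : ℂˣ) : ℂ) =
      (((w⁻¹ : rootsOfUnity 4 ℂ) : ℂˣ) : ℂ) := by
    have h1 : ‖((w : ℂˣ) : ℂ)‖ = 1 := Complex.norm_eq_one_of_mem_rootsOfUnity w.2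
    simp [Complex.inv_eq_conj h1]
  have hJ : (vecMulVec (1 : Fin d → ℂ) (star 1)).PosSemidef := posSemidef_vecMulVec_self_star _
  have h : (Matrix.of fun p q : Fin d × Fin d =>
      if (p.1 = q.1 ∧ p.2 = q.2) ∨ (p.1 = q.2 ∧ p.2 = q.1) then G p.2 q.2 else 0) =
      N⁻¹ • ∑ z, (D z * vecMulVec 1 (star 1) * (D z)ᴴ) ⊗ₖ (D z * G * (D z)ᴴ) := by
    ext p q
    have hterm (z : Fin d → rootsOfUnity 4 ℂ) :
        ((D z * vecMulVec 1 (star 1) * (D z)ᴴ) ⊗ₖ (D z * G * (D z)ᴴ)) p q =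
        (((z p.1 * (z q.1)⁻¹ * (z p.2 * (z q.2)⁻¹) : rootsOfUnity 4 ℂ) : ℂˣ) : ℂ) *
          G p.2 q.2 := by
      simp only [D, kroneckerMap_apply, diagonal_conjTranspose, mul_diagonal, diagonal_mul,
        vecMulVec_apply, Pi.star_apply, hstar]
      simp
      ring
    simp only [Matrix.smul_apply, Matrix.sum_apply, hterm, ← Finset.sum_mul, sum_phases_eq,
      of_apply, smul_eq_mul]
    split_ifs
    · change _ = N⁻¹ * (N * _)
      field_simp
    · simp
  rw [h]
  exact smul_mem_separableCone (inv_nonneg.mpr (Nat.cast_nonneg _)) <|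
    Submodule.sum_mem _ fun z _ => kronecker_mem_separableCone
      (hJ.mul_mul_conjTranspose_same _) (hG.mul_mul_conjTranspose_same _)

lemma one_add_flipOp_mem_separableCone (d : ℕ) : 1 + flipOp d ∈ separableCone d := by
  have hJ : (vecMulVec (1 : Fin d → ℂ) (star 1)).PosSemidef := posSemidef_vecMulVec_self_star _
  have hdiag : diagonal (fun p : Fin d × Fin d => if p.1 = p.2 then (1 : ℂ) else 0)
      ∈ separableCone d :=
    diagonal_mem_separableCone fun p => by split_ifs <;> simp
  convert add_mem (phaseAverage_mem_separableCone hJ) hdiag using 1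
  ext ⟨a, b⟩ ⟨c, e⟩
  simp only [flipOp, Matrix.add_apply, one_apply, diagonal_apply, of_apply, vecMulVec_apply,
    Prod.mk.injEq, Pi.one_apply, star_one, mul_one]
  by_cases h1 : a = c <;> by_cases h2 : b = e <;> by_cases h3 : a = e <;> by_cases h4 : b = c <;>
    simp_all

lemma posSemidef_smul_one_sub_ones (d : ℕ) :
    ((d : ℂ) • (1 : Matrix (Fin d) (Fin d) ℂ) - vecMulVec 1 1).PosSemidef := by
  rcases Nat.eq_zero_or_pos d with rfl | hd
  · simpa [Subsingleton.elim (vecMulVec (1 : Fin 0 → ℂ) 1) 0] using PosSemidef.zero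
  set H : Matrix (Fin d) (Fin d) ℂ := (d : ℂ) • 1 - vecMulVec 1 1 with hH
  have hd0 : (d : ℂ) ≠ 0 := by exact_mod_cast hd.ne'
  have hJJ : vecMulVec (1 : Fin d → ℂ) (1 : Fin d → ℂ) * vecMulVec 1 1 =
      (d : ℂ) • vecMulVec 1 1 := by
    ext i j
    simp [Matrix.mul_apply]
  have hsq : Hᴴ * H = (d : ℂ) • H := by
    have hherm : Hᴴ = H := by
      rw [hH, conjTranspose_sub, conjTranspose_smul, conjTranspose_vecMulVec]
      simp only [conjTranspose_one, star_one, star_natCast]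
    rw [hherm, hH, sub_mul, mul_sub, mul_sub, hJJ]
    simp [smul_sub]
  have h := (posSemidef_conjTranspose_mul_self H).smul
    (inv_nonneg.mpr (Nat.cast_nonneg d : (0 : ℂ) ≤ d))
  rwa [hsq, smul_smul, inv_mul_cancel₀ hd0, one_smul] at h

lemma smul_one_sub_flipOp_mem_separableCone (d : ℕ) :
    (d : ℂ) • 1 - flipOp d ∈ separableCone d := by
  have hdiag : diagonal (fun p : Fin d × Fin d => if p.1 = p.2 then (0 : ℂ) else 1)
      ∈ separableCone d :=
    diagonal_mem_separableCone fun p => by split_ifs <;> simp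
  convert add_mem (phaseAverage_mem_separableCone (posSemidef_smul_one_sub_ones d)) hdiag using 1
  ext ⟨a, b⟩ ⟨c, e⟩
  simp only [flipOp, Matrix.add_apply, Matrix.sub_apply, Matrix.smul_apply, one_apply,
    diagonal_apply, of_apply, vecMulVec_apply, Prod.mk.injEq, Pi.one_apply, mul_one, smul_eq_mul]
  by_cases h1 : a = c <;> by_cases h2 : b = e <;> by_cases h3 : a = e <;> by_cases h4 : b = c <;>
    simp_all

lemma trace_kronecker_mul_flipOp {d : ℕ} (A B : Matrix (Fin d) (Fin d) ℂ) :
    ((A ⊗ₖ B) * flipOp d).trace = (A * B).trace := by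
  simp [trace, Matrix.mul_apply, flipOp, Fintype.sum_prod_type, ite_and]

lemma trace_flipOp (d : ℕ) : (flipOp d).trace = d := by
  simp [trace, flipOp, Fintype.sum_prod_type, ite_and]

lemma flipOp_mul_self (d : ℕ) : flipOp d * flipOp d = 1 := by
  ext ⟨a, b⟩ ⟨c, e⟩
  simp [Matrix.mul_apply, flipOp, Fintype.sum_prod_type, ite_and, one_apply]

open scoped MatrixOrder Matrix.Norms.L2Operator in
lemma trace_mul_nonneg_of_posSemidef {n : Type*} [Fintype n]
    {A B : Matrix n n ℂ} (hA : A.PosSemidef) (hB : B.PosSemidef) : 0 ≤ (A * B).trace := by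
  classical
  obtain ⟨C, rfl⟩ := CStarAlgebra.nonneg_iff_eq_star_mul_self.mp hB.nonneg
  rw [star_eq_conjTranspose, ← Matrix.mul_assoc, Matrix.trace_mul_comm, ← Matrix.mul_assoc]
  exact (hA.mul_mul_conjTranspose_same C).trace_nonneg

/-- The Werner state `W_φ = ((d − φ)·I + (d·φ − 1)·V) / (d³ − d)` with parameter
`φ ∈ [−1, 1]` is separable if and only if `φ ≥ 0`. -/
theorem werner_separable_iff (d : ℕ) (hd : 2 ≤ d) (φ : ℝ)
    (hφl : -1 ≤ φ) (hφu : φ ≤ 1) :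
    SeparableState d
        (((d : ℂ) ^ 3 - (d : ℂ))⁻¹ •
          (((d : ℂ) - (φ : ℂ)) • (1 : Matrix (Fin d × Fin d) (Fin d × Fin d) ℂ) +
            ((d : ℂ) * (φ : ℂ) - 1) • flipOp d)) ↔ 0 ≤ φ := by
  have hpos : 0 < (d : ℝ) ^ 3 - d := by
    have : (2 : ℝ) ≤ d := by exact_mod_cast hd
    nlinarith [mul_pos (by linarith : (0 : ℝ) < d) (by linarith : (0 : ℝ) < d - 1)]
  have hN : (d : ℂ) ^ 3 - d ≠ 0 := by exact_mod_cast hpos.ne'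
  have hNnonneg : (0 : ℂ) ≤ ((d : ℂ) ^ 3 - d)⁻¹ :=
    inv_nonneg.mpr (by exact_mod_cast hpos.le)
  constructor
  · rintro ⟨n, p, A, B, hp, -, hA, hB, h⟩
    have htr := congrArg (fun M => (M * flipOp d).trace) h
    simp only [Matrix.smul_mul, Matrix.add_mul, Matrix.one_mul, flipOp_mul_self, trace_smul,
      trace_add, trace_flipOp, trace_one, Fintype.card_prod, Fintype.card_fin, Finset.sum_mul,
      Matrix.trace_sum, trace_kronecker_mul_flipOp, smul_eq_mul, Nat.cast_mul] at htr
    have hφ : (φ : ℂ) = ∑ i, (p i : ℂ) * (A i * B i).trace := by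
      rw [← htr, eq_inv_mul_iff_mul_eq₀ hN]
      ring
    have : (0 : ℂ) ≤ φ := hφ ▸ Finset.sum_nonneg fun i _ =>
      mul_nonneg (by exact_mod_cast hp i) (trace_mul_nonneg_of_posSemidef (hA i).1 (hB i).1)
    exact_mod_cast this
  · intro hφ
    apply separableState_of_mem_separableCone
    · have hα : (0 : ℂ) ≤ ((d : ℂ) - 1) * φ := by
        have : (0 : ℝ) ≤ ((d : ℝ) - 1) * φ :=
          mul_nonneg (by linarith [show (2 : ℝ) ≤ d by exact_mod_cast hd]) hφ
        exact_mod_cast this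
      have hβ : (0 : ℂ) ≤ 1 - φ := by exact_mod_cast sub_nonneg.mpr hφu
      convert smul_mem_separableCone hNnonneg (add_mem
        (smul_mem_separableCone hα (one_add_flipOp_mem_separableCone d))
        (smul_mem_separableCone hβ (smul_one_sub_flipOp_mem_separableCone d))) using 2
      module
    · simp only [trace_smul, trace_add, trace_flipOp, trace_one, Fintype.card_prod,
        Fintype.card_fin, smul_eq_mul, Nat.cast_mul]
      rw [inv_mul_eq_one₀ hN]
      ring
end

section
/- Let x, y ∈ ℝ³ be unit vectors. Then ∫_{S²} (x·λ)·sign(y·λ) dλ = 2π·(x·y), where the integral is with respect to the surface measure on the unit sphere S² ⊂ ℝ³. Equivalently, −(1/2π)∫_{S²} |x·λ|·sign(x·λ)·sign(y·λ) dλ = −(x·y), which is the singlet correlation E(AB) = −x·y reproduced by the biased local hidden variable model with density |x·λ|/(2π) and response functions A = −sign(x·λ), B = sign(y·λ). -/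
open MeasureTheory
open scoped RealInnerProductSpace

/-- The sign function: `sign(z) = 1` if `z ≥ 0` and `−1` if `z < 0`. -/
noncomputable def sgn (z : ℝ) : ℝ := if 0 ≤ z then 1 else -1

open Set Metric Module

/-- Integration in polar coordinates of a function that splits into an angular and a radial
factor. -/
lemma integral_eq_integral_toSphere_mul_integral_Ioi {E : Type*} [NormedAddCommGroup E]
    [NormedSpace ℝ E] [FiniteDimensional ℝ E] [Nontrivial E] [MeasurableSpace E] [BorelSpace E]
    (μ : Measure E) [μ.IsAddHaarMeasure] {f : E → ℝ} {g : sphere (0 : E) 1 → ℝ} {h : ℝ → ℝ}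
    (hf : ∀ (s : sphere (0 : E) 1) (r : ℝ), 0 < r → f (r • (s : E)) = g s * h r) :
    ∫ w, f w ∂μ =
      (∫ s, g s ∂μ.toSphere) * ∫ r in Ioi (0 : ℝ), r ^ (finrank ℝ E - 1) * h r :=
  calc
    ∫ w, f w ∂μ = ∫ w : ({0}ᶜ : Set E), f w ∂(μ.comap (↑)) := by
      rw [integral_subtype_comap (measurableSet_singleton _).compl f, restrict_compl_singleton]
    _ = ∫ p, g p.1 * h p.2 ∂μ.toSphere.prod (.volumeIoiPow (finrank ℝ E - 1)) := by
      rw [← μ.measurePreserving_homeomorphUnitSphereProd.integral_comp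
        (Homeomorph.measurableEmbedding _)]
      refine integral_congr_ae (.of_forall fun w ↦ ?_)
      have hw := congrArg Subtype.val ((homeomorphUnitSphereProd E).symm_apply_apply w)
      rw [homeomorphUnitSphereProd_symm_apply_coe] at hw
      dsimp only
      rw [← hf _ _ (homeomorphUnitSphereProd E w).2.2, hw]
    _ = (∫ s, g s ∂μ.toSphere) * ∫ r : Ioi (0 : ℝ), h r ∂.volumeIoiPow (finrank ℝ E - 1) :=
      integral_prod_mul g fun r : Ioi (0 : ℝ) ↦ h r
    _ = _ := by
      simp only [Measure.volumeIoiPow, ENNReal.ofReal]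
      rw [integral_withDensity_eq_integral_smul
          (measurable_subtype_coe.pow_const _).real_toNNReal,
        integral_subtype_comap measurableSet_Ioi
          fun a ↦ Real.toNNReal (a ^ (finrank ℝ E - 1)) • h a,
        setIntegral_congr_fun measurableSet_Ioi fun r hr ↦ ?_]
      rw [NNReal.smul_def, Real.coe_toNNReal _ (pow_nonneg hr.out.le _), smul_eq_mul]

lemma measurable_sgn : Measurable sgn :=
  Measurable.ite measurableSet_Ici measurable_const measurable_const

lemma abs_sgn (z : ℝ) : |sgn z| = 1 := by
  unfold sgn; split_ifs <;> simp

lemma mul_sgn_self (z : ℝ) : z * sgn z = |z| := by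
  unfold sgn
  split_ifs with hz
  · rw [mul_one, abs_of_nonneg hz]
  · rw [mul_neg_one, abs_of_neg (not_le.1 hz)]

lemma abs_mul_sgn_self (z : ℝ) : |z| * sgn z = z := by
  unfold sgn
  split_ifs with hz
  · rw [mul_one, abs_of_nonneg hz]
  · rw [mul_neg_one, abs_of_neg (not_le.1 hz), neg_neg]

lemma sgn_mul_of_pos {r : ℝ} (hr : 0 < r) (z : ℝ) : sgn (r * z) = sgn z := by
  simp only [sgn, mul_nonneg_iff_of_pos_left hr]

lemma integral_Ioi_pow_three_mul_exp_neg_sq :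
    ∫ r in Ioi (0 : ℝ), r ^ 2 * (r * Real.exp (-r ^ 2)) = 1 / 2 := by
  have h := integral_rpow_mul_exp_neg_rpow (p := 2) (q := 3) (by norm_num) (by norm_num)
  rw [show ((3 : ℝ) + 1) / 2 = 2 by norm_num, Real.Gamma_two, mul_one] at h
  rw [← h]
  refine setIntegral_congr_fun measurableSet_Ioi fun r _ ↦ ?_
  norm_cast
  ring

lemma integral_abs_mul_exp_neg_sq : ∫ t : ℝ, |t| * Real.exp (-t ^ 2) = 1 := by
  have h := integral_rpow_mul_exp_neg_rpow (p := 2) (q := 1) (by norm_num) (by norm_num)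
  have habs := integral_comp_abs (f := fun t : ℝ ↦ t * Real.exp (-t ^ 2))
  simp only [sq_abs] at habs
  norm_num at h
  rw [habs, h]
  norm_num

lemma integral_mul_exp_neg_sq : ∫ t : ℝ, t * Real.exp (-t ^ 2) = 0 := by
  have h := integral_neg_eq_self (fun t : ℝ ↦ t * Real.exp (-t ^ 2)) volume
  simp only [neg_mul, neg_sq, integral_neg] at h
  linarith

/-- The one-dimensional factors of `w i * sgn (w 0) * exp (-‖w‖ ^ 2)`: a Gaussian times optional
factors `t` and `sgn t`. -/
noncomputable def gaussianFactor (p q : Prop) [Decidable p] [Decidable q] (t : ℝ) : ℝ :=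
  (if p then t else 1) * (if q then sgn t else 1) * Real.exp (-t ^ 2)

lemma integrable_gaussianFactor (p q : Prop) [Decidable p] [Decidable q] :
    Integrable (gaussianFactor p q) := by
  have hp : Integrable fun t : ℝ ↦ (if p then t else 1) * Real.exp (-t ^ 2) := by
    split_ifs
    · simpa using integrable_mul_exp_neg_mul_sq one_pos
    · simpa using integrable_exp_neg_mul_sq one_pos
  have hq : Measurable fun t : ℝ ↦ if q then sgn t else 1 := by
    split_ifs
    exacts [measurable_sgn, measurable_const]
  refine (hp.bdd_mul (c := 1) hq.aestronglyMeasurable (.of_forall fun t ↦ ?_)).congr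
    (.of_forall fun t ↦ ?_)
  · split_ifs <;> simp [abs_sgn]
  · simp only [gaussianFactor]; ring

lemma prod_gaussianFactor (i : Fin 3) (w : Fin 3 → ℝ) :
    ∏ j, gaussianFactor (j = i) (j = 0) (w j) =
      w i * sgn (w 0) * Real.exp (-∑ j, w j ^ 2) := by
  simp only [gaussianFactor, Finset.prod_mul_distrib, Finset.prod_ite_eq', Finset.mem_univ,
    if_true, ← Real.exp_sum, Finset.sum_neg_distrib]

lemma integrable_coord_mul_sgn_mul_exp (i : Fin 3) :
    Integrable fun w : Fin 3 → ℝ ↦ w i * sgn (w 0) * Real.exp (-∑ j, w j ^ 2) := by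
  simp only [← prod_gaussianFactor]
  exact Integrable.fintype_prod fun j ↦ integrable_gaussianFactor (j = i) (j = 0)

lemma integral_coord_mul_sgn_mul_exp (i : Fin 3) :
    ∫ w : Fin 3 → ℝ, w i * sgn (w 0) * Real.exp (-∑ j, w j ^ 2) =
      if i = 0 then Real.pi else 0 := by
  simp only [← prod_gaussianFactor]
  rw [integral_fintype_prod_volume_eq_prod fun j ↦ gaussianFactor (j = i) (j = 0)]
  split_ifs with hi
  · have hgauss : ∫ t : ℝ, Real.exp (-t ^ 2) = √Real.pi := by simpa using integral_gaussian 1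
    subst hi
    simp [Fin.prod_univ_three, gaussianFactor, mul_sgn_self, integral_abs_mul_exp_neg_sq, hgauss,
      Real.mul_self_sqrt Real.pi_pos.le]
  · refine Finset.prod_eq_zero (Finset.mem_univ i) ?_
    simp [gaussianFactor, hi, integral_mul_exp_neg_sq]

lemma exists_orthonormalBasis_zero_eq {y : EuclideanSpace ℝ (Fin 3)} (hy : ‖y‖ = 1) :
    ∃ b : OrthonormalBasis (Fin 3) ℝ (EuclideanSpace ℝ (Fin 3)), b 0 = y := by
  obtain ⟨b, hb⟩ := Orthonormal.exists_orthonormalBasis_extension_of_card_eq (𝕜 := ℝ)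
    (ι := Fin 3) (v := fun _ ↦ y) (s := {0}) (by simp)
    (by
      rw [orthonormal_iff_ite]
      intro i j
      simp [Subsingleton.elim i j, hy])
  exact ⟨b, hb 0 rfl⟩

lemma integral_inner_mul_sgn_inner_mul_exp (x : EuclideanSpace ℝ (Fin 3))
    {y : EuclideanSpace ℝ (Fin 3)} (hy : ‖y‖ = 1) :
    ∫ w : EuclideanSpace ℝ (Fin 3), ⟪x, w⟫ * sgn ⟪y, w⟫ * Real.exp (-‖w‖ ^ 2) =
      Real.pi * ⟪x, y⟫ := by
  obtain ⟨b, rfl⟩ := exists_orthonormalBasis_zero_eq hy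
  have hmp := b.measurePreserving_measurableEquiv.trans
    (EuclideanSpace.volume_preserving_symm_measurableEquiv_toLp (Fin 3))
  have hcoord (w : EuclideanSpace ℝ (Fin 3)) :
      ⟪x, w⟫ * sgn ⟪b 0, w⟫ * Real.exp (-‖w‖ ^ 2) =
        ∑ i, ⟪x, b i⟫ * (⟪b i, w⟫ * sgn ⟪b 0, w⟫ * Real.exp (-∑ j, ⟪b j, w⟫ ^ 2)) := by
    rw [← b.sum_inner_mul_inner x w, ← b.sum_sq_inner_right w, Finset.sum_mul, Finset.sum_mul]
    exact Finset.sum_congr rfl fun i _ ↦ by ring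
  calc
    _ = ∫ w : Fin 3 → ℝ,
          ∑ i, ⟪x, b i⟫ * (w i * sgn (w 0) * Real.exp (-∑ j, w j ^ 2)) := by
      rw [← hmp.integral_comp']
      refine integral_congr_ae (.of_forall fun w ↦ ?_)
      refine (hcoord w).trans ?_
      simp only [← b.repr_apply_apply]
      rfl
    _ = ∑ i, ⟪x, b i⟫ * if i = 0 then Real.pi else 0 := by
      rw [integral_finsetSum _ fun i _ ↦ (integrable_coord_mul_sgn_mul_exp i).const_mul _]
      simp only [integral_const_mul, integral_coord_mul_sgn_mul_exp]
    _ = Real.pi * ⟪x, b 0⟫ := by simp [mul_comm]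

lemma integral_inner_mul_sgn_inner_toSphere (x : EuclideanSpace ℝ (Fin 3))
    {y : EuclideanSpace ℝ (Fin 3)} (hy : ‖y‖ = 1) :
    ∫ v : sphere (0 : EuclideanSpace ℝ (Fin 3)) 1,
        ⟪x, (v : EuclideanSpace ℝ (Fin 3))⟫ * sgn ⟪y, (v : EuclideanSpace ℝ (Fin 3))⟫
      ∂((volume : Measure (EuclideanSpace ℝ (Fin 3))).toSphere) = 2 * Real.pi * ⟪x, y⟫ := by
  have hpolar := integral_eq_integral_toSphere_mul_integral_Ioi
    (volume : Measure (EuclideanSpace ℝ (Fin 3)))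
    (f := fun w ↦ ⟪x, w⟫ * sgn ⟪y, w⟫ * Real.exp (-‖w‖ ^ 2))
    (g := fun v ↦ ⟪x, (v : EuclideanSpace ℝ (Fin 3))⟫ * sgn ⟪y, (v : EuclideanSpace ℝ (Fin 3))⟫)
    (h := fun r ↦ r * Real.exp (-r ^ 2)) fun v r hr ↦ by
      simp only [inner_smul_right, sgn_mul_of_pos hr, norm_smul, norm_eq_of_mem_sphere,
        mul_one, Real.norm_eq_abs, sq_abs]
      ring
  rw [integral_inner_mul_sgn_inner_mul_exp x hy, finrank_euclideanSpace_fin,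
    integral_Ioi_pow_three_mul_exp_neg_sq] at hpolar
  linarith

/-- For unit vectors `x, y ∈ ℝ³`, `∫_{S²} (x·λ)·sign(y·λ) dλ = 2π·(x·y)`;
equivalently `−(1/2π)∫_{S²} |x·λ|·sign(x·λ)·sign(y·λ) dλ = −(x·y)`, the singlet
correlation reproduced by the biased local hidden variable model. -/
theorem integral_inner_sign_sphere (x y : EuclideanSpace ℝ (Fin 3))
    (hx : ‖x‖ = 1) (hy : ‖y‖ = 1) :
    (∫ v : Metric.sphere (0 : EuclideanSpace ℝ (Fin 3)) 1,
        ⟪x, (v : EuclideanSpace ℝ (Fin 3))⟫ * sgn ⟪y, (v : EuclideanSpace ℝ (Fin 3))⟫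
      ∂((volume : Measure (EuclideanSpace ℝ (Fin 3))).toSphere) = 2 * Real.pi * ⟪x, y⟫) ∧
    (-(1 / (2 * Real.pi)) *
        ∫ v : Metric.sphere (0 : EuclideanSpace ℝ (Fin 3)) 1,
          |⟪x, (v : EuclideanSpace ℝ (Fin 3))⟫| * sgn ⟪x, (v : EuclideanSpace ℝ (Fin 3))⟫ *
            sgn ⟪y, (v : EuclideanSpace ℝ (Fin 3))⟫
        ∂((volume : Measure (EuclideanSpace ℝ (Fin 3))).toSphere) = -⟪x, y⟫) := by
  have hsphere := integral_inner_mul_sgn_inner_toSphere x hy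
  refine ⟨hsphere, ?_⟩
  simp only [abs_mul_sgn_self]
  rw [hsphere]
  field_simp
end
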